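/- Let X be a real m×n matrix (m ≥ n) with singular value decomposition X = UΣVᵀ, where U is m×n with orthonormal columns, V is n×n orthogonal, and Σ = diag(σ₁,…,σ_n) with σ₁ ≥ … ≥ σ_n ≥ 0. Let Λ = diag(λ₁,…,λ_n) with λ_i > 0, let Γ = Λ^{1/2}Vᵀ, and fix 1 ≤ k ≤ n. Assume σ_i⁴/(σ_i²+λ_i) ≥ σ_{i+1}⁴/(σ_{i+1}²+λ_{i+1}) for all 1 ≤ i < n. Then Ŵ = V_k · diag(σ₁²/(σ₁²+λ₁), …, σ_k²/(σ_k²+λ_k)) · V_kᵀ minimizes ‖X − XW‖_F² + ‖ΓW‖_F² over all real n×n matrices W with rank(W) ≤ k, where V_k denotes the first k columns of V. -/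

import Mathlib

open Matrix BigOperators

noncomputable def frobSq {m n : Type*} [Fintype m] [Fintype n] (A : Matrix m n ℝ) : ℝ :=
  ∑ i, ∑ j, (A i j) ^ 2

lemma frobSq_eq_trace {m n : Type*} [Fintype m] [Fintype n] (A : Matrix m n ℝ) :
    frobSq A = (Aᵀ * A).trace := by
  unfold frobSq
  rw [Finset.sum_comm]
  simp [Matrix.trace, Matrix.mul_apply, pow_two]

lemma frobSq_left {m n p : Type*} [Fintype m] [Fintype n] [Fintype p] [DecidableEq n]
    (U : Matrix m n ℝ) (A : Matrix n p ℝ) (hU : Uᵀ * U = 1) : frobSq (U * A) = frobSq A := by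
  rw [frobSq_eq_trace, frobSq_eq_trace, Matrix.transpose_mul, Matrix.mul_assoc,
    ← Matrix.mul_assoc Uᵀ, hU, Matrix.one_mul]

lemma frobSq_transpose {m n : Type*} [Fintype m] [Fintype n] (A : Matrix m n ℝ) :
    frobSq Aᵀ = frobSq A := by
  unfold frobSq
  rw [Finset.sum_comm]
  rfl

lemma frobSq_right {m n : Type*} [Fintype m] [Fintype n] [DecidableEq n]
    (A : Matrix m n ℝ) (V : Matrix n n ℝ) (hV : Vᵀ * V = 1) : frobSq (A * Vᵀ) = frobSq A := by
  rw [← frobSq_transpose, Matrix.transpose_mul, Matrix.transpose_transpose,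
    frobSq_left _ _ hV, frobSq_transpose]

lemma sum_castLE_eq {k n : ℕ} (hk : k ≤ n) (f : Fin n → ℝ) :
    ∑ l : Fin k, f (Fin.castLE hk l) = ∑ i : Fin n, if (i : ℕ) < k then f i else 0 := by
  obtain ⟨t, rfl⟩ := Nat.exists_eq_add_of_le hk
  rw [Fin.sum_univ_add]
  simp
  rfl

/-- The objective in the rotated coordinates. -/
lemma obj_eq {m n : ℕ} (X U : Matrix (Fin m) (Fin n) ℝ) (V : Matrix (Fin n) (Fin n) ℝ)
    (σ lam : Fin n → ℝ)
    (hU : Uᵀ * U = 1) (hV : Vᵀ * V = 1)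
    (hX : X = U * Matrix.diagonal σ * Vᵀ)
    (hlampos : ∀ i, 0 < lam i)
    (Γ : Matrix (Fin n) (Fin n) ℝ)
    (hΓ : Γ = Matrix.diagonal (fun i => Real.sqrt (lam i)) * Vᵀ)
    (B : Matrix (Fin n) (Fin n) ℝ) :
    frobSq (X - X * (V * B * Vᵀ)) + frobSq (Γ * (V * B * Vᵀ)) =
      ∑ i, ∑ j, (σ i ^ 2 * ((1 : Matrix (Fin n) (Fin n) ℝ) i j - B i j) ^ 2
        + lam i * B i j ^ 2) := by
  have h1 : X - X * (V * B * Vᵀ) = U * (Matrix.diagonal σ * (1 - B)) * Vᵀ := by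
    have : X * (V * B * Vᵀ) = U * Matrix.diagonal σ * (Vᵀ * V) * B * Vᵀ := by
      rw [hX]; simp only [Matrix.mul_assoc]
    rw [this, hV, hX]
    simp only [Matrix.mul_sub, Matrix.sub_mul, Matrix.mul_one, Matrix.mul_assoc]
  have h2 : Γ * (V * B * Vᵀ) = Matrix.diagonal (fun i => Real.sqrt (lam i)) * B * Vᵀ := by
    have : Γ * (V * B * Vᵀ) =
        Matrix.diagonal (fun i => Real.sqrt (lam i)) * (Vᵀ * V) * B * Vᵀ := by
      rw [hΓ]; simp only [Matrix.mul_assoc]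
    rw [this, hV, Matrix.mul_one]
  rw [h1, h2, frobSq_right _ _ hV, frobSq_right _ _ hV, frobSq_left _ _ hU]
  unfold frobSq
  rw [← Finset.sum_add_distrib]
  refine Finset.sum_congr rfl fun i _ => ?_
  rw [← Finset.sum_add_distrib]
  refine Finset.sum_congr rfl fun j _ => ?_
  simp only [Matrix.diagonal_mul, Matrix.sub_apply, mul_pow, Real.sq_sqrt (hlampos i).le]

/-- Orthonormal kernel coordinates. -/
lemma kernel_weights {n k : ℕ} (B : Matrix (Fin n) (Fin n) ℝ) (hB : B.rank ≤ k) :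
    ∃ q : Fin n → ℝ, (∀ i, 0 ≤ q i) ∧ (∀ i, q i ≤ 1) ∧ ((n : ℝ) ≤ k + ∑ i, q i) ∧
      ∀ i (w : ℝ), w ^ 2 * q i ≤ ∑ j, (B i j - w * (1 : Matrix (Fin n) (Fin n) ℝ) i j) ^ 2 := by
  classical
  let T : EuclideanSpace ℝ (Fin n) →ₗ[ℝ] EuclideanSpace ℝ (Fin n) := Matrix.toEuclideanLin B
  let K := LinearMap.ker T
  let b := stdOrthonormalBasis ℝ K
  let v : Fin (Module.finrank ℝ K) → EuclideanSpace ℝ (Fin n) := fun j => (b j : _)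
  have hv : Orthonormal ℝ v := b.orthonormal.comp_linearIsometry K.subtypeₗᵢ
  have hker : ∀ l i, ∑ j, B i j * v l j = 0 := by
    intro l i
    have h : T (v l) = 0 := (b l).2
    have := congrArg (fun x : EuclideanSpace ℝ (Fin n) => x i) h
    simpa [T, Matrix.toEuclideanLin, Matrix.mulVec, dotProduct] using this
  have hbes : ∀ a : EuclideanSpace ℝ (Fin n), ∑ l, (∑ j, a j * v l j) ^ 2 ≤ ∑ j, a j ^ 2 := by
    intro a
    have := hv.sum_inner_products_le (x := a) (s := Finset.univ)
    simpa [EuclideanSpace.norm_sq_eq, PiLp.inner_apply, sq_abs] using this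
  have hrank : Module.finrank ℝ (LinearMap.range T) = B.rank := by
    rw [Matrix.rank_eq_finrank_range_toLin B (EuclideanSpace.basisFun (Fin n) ℝ).toBasis
      (EuclideanSpace.basisFun (Fin n) ℝ).toBasis]
    rfl
  have hrn := LinearMap.finrank_range_add_finrank_ker T
  refine ⟨fun i => ∑ l, v l i ^ 2, fun i => Finset.sum_nonneg fun l _ => sq_nonneg _, ?_, ?_, ?_⟩
  · intro i
    have := hbes (EuclideanSpace.single i 1)
    simpa [Pi.single_apply] using this
  · rw [Finset.sum_comm]
    have : ∀ l, ∑ i, v l i ^ 2 = 1 := by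
      intro l
      have h := hv.1 l
      have h2 : ‖v l‖ ^ 2 = 1 := by rw [h]; norm_num
      simpa [EuclideanSpace.norm_sq_eq, sq_abs] using h2
    simp only [this]
    simp only [finrank_euclideanSpace, Fintype.card_fin] at hrn
    simp only [Finset.sum_const, Finset.card_univ, Fintype.card_fin, nsmul_eq_mul, mul_one]
    have : n ≤ k + Module.finrank ℝ K := by
      change _ + Module.finrank ℝ K = n at hrn
      omega
    exact_mod_cast this
  · intro i w
    have := hbes (WithLp.toLp 2 fun j => B i j - w * (1 : Matrix (Fin n) (Fin n) ℝ) i j)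
    refine le_trans (le_of_eq ?_) this
    rw [Finset.mul_sum]
    refine Finset.sum_congr rfl fun l _ => ?_
    have : ∑ j, (B i j - w * (1 : Matrix (Fin n) (Fin n) ℝ) i j) * v l j = - (w * v l i) := by
      simp only [sub_mul, Finset.sum_sub_distrib, hker]
      simp [Matrix.one_apply]
    simp only [this]
    ring

theorem stmt_8 {m n : ℕ} (hmn : n ≤ m)
    (X U : Matrix (Fin m) (Fin n) ℝ) (V : Matrix (Fin n) (Fin n) ℝ)
    (σ lam : Fin n → ℝ)
    (hU : Uᵀ * U = 1) (hV : Vᵀ * V = 1)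
    (hσord : ∀ i j : Fin n, i ≤ j → σ j ≤ σ i) (hσnn : ∀ i, 0 ≤ σ i)
    (hX : X = U * Matrix.diagonal σ * Vᵀ)
    (hlampos : ∀ i, 0 < lam i)
    (Γ : Matrix (Fin n) (Fin n) ℝ)
    (hΓ : Γ = Matrix.diagonal (fun i => Real.sqrt (lam i)) * Vᵀ)
    (k : ℕ) (hk1 : 1 ≤ k) (hk : k ≤ n)
    (hord : ∀ i j : Fin n, i ≤ j →
      σ j ^ 4 / (σ j ^ 2 + lam j) ≤ σ i ^ 4 / (σ i ^ 2 + lam i)) :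
    let Vk : Matrix (Fin n) (Fin k) ℝ := V.submatrix id (Fin.castLE hk)
    let What : Matrix (Fin n) (Fin n) ℝ :=
      Vk * Matrix.diagonal (fun i : Fin k =>
        σ (Fin.castLE hk i) ^ 2 / (σ (Fin.castLE hk i) ^ 2 + lam (Fin.castLE hk i))) * Vkᵀ
    What.rank ≤ k ∧
    ∀ W : Matrix (Fin n) (Fin n) ℝ, W.rank ≤ k →
      frobSq (X - X * What) + frobSq (Γ * What) ≤ frobSq (X - X * W) + frobSq (Γ * W) := by
  intro Vk What
  refine ⟨?_, ?_⟩
  · calc What.rank ≤ (Vkᵀ).rank := Matrix.rank_mul_le_right _ _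
      _ ≤ k := by simpa using Matrix.rank_le_card_height (Vkᵀ)
  intro W hW
  have hV' : V * Vᵀ = 1 := mul_eq_one_comm.mp hV
  let w : Fin n → ℝ := fun i => σ i ^ 2 / (σ i ^ 2 + lam i)
  let g : Fin n → ℝ := fun i => σ i ^ 4 / (σ i ^ 2 + lam i)
  have hd : ∀ i, 0 < σ i ^ 2 + lam i := fun i => by have := hlampos i; positivity
  have hWhat : What = V * Matrix.diagonal (fun i : Fin n => if (i : ℕ) < k then w i else 0) * Vᵀ := by
    ext a c
    simp only [What]
    rw [Matrix.mul_apply, Matrix.mul_apply]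
    simp only [Matrix.mul_diagonal, Matrix.transpose_apply, Vk, Matrix.submatrix_apply, id]
    rw [sum_castLE_eq hk (fun l => V a l * (σ l ^ 2 / (σ l ^ 2 + lam l)) * V c l)]
    refine Finset.sum_congr rfl fun i _ => ?_
    split_ifs <;> simp [w]
  have hWB : W = V * (Vᵀ * W * V) * Vᵀ := by
    have : V * (Vᵀ * W * V) * Vᵀ = (V * Vᵀ) * W * (V * Vᵀ) := by simp only [Matrix.mul_assoc]
    rw [this, hV']; simp
  have hBr : (Vᵀ * W * V).rank ≤ k :=
    (Matrix.rank_mul_le_left _ _).trans ((Matrix.rank_mul_le_right _ _).trans hW)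
  generalize hB : Vᵀ * W * V = B at hWB hBr
  rw [hWhat, hWB, obj_eq X U V σ lam hU hV hX hlampos Γ hΓ,
    obj_eq X U V σ lam hU hV hX hlampos Γ hΓ]
  -- completing the square, row by row
  have hsq : ∀ (C : Matrix (Fin n) (Fin n) ℝ) i,
      ∑ j, (σ i ^ 2 * ((1 : Matrix (Fin n) (Fin n) ℝ) i j - C i j) ^ 2 + lam i * C i j ^ 2)
      = (σ i ^ 2 - g i) + (σ i ^ 2 + lam i) *
        ∑ j, (C i j - w i * (1 : Matrix (Fin n) (Fin n) ℝ) i j) ^ 2 := by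
    intro C i
    have h0 : σ i ^ 2 - g i = ∑ j, (σ i ^ 2 - g i) * (1 : Matrix (Fin n) (Fin n) ℝ) i j := by
      simp [Matrix.one_apply]
    rw [h0, Finset.mul_sum, ← Finset.sum_add_distrib]
    refine Finset.sum_congr rfl fun j _ => ?_
    have hne := (hd i).ne'
    by_cases hij : i = j
    · simp only [Matrix.one_apply, hij, if_true, g, w]
      rw [hij] at hne
      field_simp
      ring
    · simp only [Matrix.one_apply, hij, if_false]
      ring
  have hgw : ∀ i, (σ i ^ 2 + lam i) * w i ^ 2 = g i := by
    intro i
    have hne := (hd i).ne'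
    simp only [w, g]
    field_simp
  simp only [hsq]
  obtain ⟨q, hq0, hq1, hqs, hq⟩ := kernel_weights B hBr
  rw [Finset.sum_add_distrib, Finset.sum_add_distrib]
  refine add_le_add le_rfl ?_
  have hL : ∀ i, (σ i ^ 2 + lam i) * ∑ j, (Matrix.diagonal
      (fun i : Fin n => if (i : ℕ) < k then w i else 0) i j
        - w i * (1 : Matrix (Fin n) (Fin n) ℝ) i j) ^ 2 = if (i : ℕ) < k then 0 else g i := by
    intro i
    rw [← hgw i]
    have : ∀ j, (Matrix.diagonal (fun i : Fin n => if (i : ℕ) < k then w i else 0) i j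
        - w i * (1 : Matrix (Fin n) (Fin n) ℝ) i j) ^ 2
        = if i = j then (if (i : ℕ) < k then 0 else w i ^ 2) else 0 := by
      intro j
      by_cases hij : i = j
      · subst hij
        by_cases hik : (i : ℕ) < k <;> simp [hik]
      · simp [hij]
    simp only [this]
    simp
  have hR : ∀ i, g i * q i ≤ (σ i ^ 2 + lam i) *
      ∑ j, (B i j - w i * (1 : Matrix (Fin n) (Fin n) ℝ) i j) ^ 2 := by
    intro i
    rw [← hgw i, mul_assoc]
    exact mul_le_mul_of_nonneg_left (hq i (w i)) (hd i).le
  simp only [hL]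
  refine le_trans ?_ (Finset.sum_le_sum fun i _ => hR i)
  -- rearrangement
  let i0 : Fin n := ⟨k - 1, by omega⟩
  have ht : 0 ≤ g i0 := by
    rw [← hgw]; have := (hd i0).le; positivity
  have hterm : ∀ i : Fin n, (if (i : ℕ) < k then 0 else g i) +
      g i0 * (q i - if (i : ℕ) < k then 0 else 1) ≤ g i * q i := by
    intro i
    split_ifs with hik
    · have : g i0 ≤ g i := hord i i0 (by simp only [i0, Fin.le_def]; omega)
      nlinarith [hq0 i]
    · have : g i ≤ g i0 := hord i0 i (by simp only [i0, Fin.le_def]; omega)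
      nlinarith [hq1 i]
  have hcount : ∑ i : Fin n, (if (i : ℕ) < k then (0 : ℝ) else 1) = n - k := by
    have h1 := sum_castLE_eq hk (fun _ => (1 : ℝ))
    have h2 : ∀ i : Fin n, (if (i : ℕ) < k then (0 : ℝ) else 1)
        = 1 - if (i : ℕ) < k then (1 : ℝ) else 0 := by
      intro i; split_ifs <;> norm_num
    simp only [h2, Finset.sum_sub_distrib, ← h1]
    simp
  have hsum := Finset.sum_le_sum (s := Finset.univ) fun i _ => hterm i
  rw [Finset.sum_add_distrib, ← Finset.mul_sum, Finset.sum_sub_distrib, hcount] at hsum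
  have : 0 ≤ g i0 * (∑ i, q i - ((n : ℝ) - k)) := mul_nonneg ht (by linarith)
  linarith
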